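/- From tasks to interval-sequential objects: For every task T there exists an interval-sequential object O_T (with a single operation) such that an execution E satisfies T if and only if E is interval-linearizable with respect to O_T. -/

import Mathlib

/-! ## One-shot executions, interval-sequential objects, interval-linearizability, tasks -/

/-- An event: an invocation of the (single) operation by a process with an input value,
or a response to a process with an output value. -/
inductive Ev (Proc In Out : Type) where
  | inv (p : Proc) (x : In)
  | res (p : Proc) (y : Out)
deriving DecidableEq

namespace Ev

variable {Proc In Out : Type}

/-- The process issuing/receiving the event. -/
def proc : Ev Proc In Out → Proc
  | .inv p _ => p
  | .res p _ => p

/-- Is the event an invocation? -/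
def isInv : Ev Proc In Out → Bool
  | .inv _ _ => true
  | _ => false

/-- Is the event a response? -/
def isRes : Ev Proc In Out → Bool
  | .res _ _ => true
  | _ => false

end Ev

variable {Proc In Out : Type} [DecidableEq Proc] [DecidableEq In] [DecidableEq Out]

/-- Projection of an execution (a finite sequence of events) onto a process. -/
def projP (E : List (Ev Proc In Out)) (p : Proc) : List (Ev Proc In Out) :=
  E.filter (fun e => decide (e.proc = p))

/-- A well-formed one-shot execution: each process's subsequence is empty, a single
invocation, or an invocation followed by its matching response. -/
def OneShotWF (E : List (Ev Proc In Out)) : Prop :=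
  ∀ p : Proc,
    projP E p = [] ∨ (∃ x, projP E p = [Ev.inv p x]) ∨
      ∃ x y, projP E p = [Ev.inv p x, Ev.res p y]

/-- `comp E`: the execution `E` with its pending invocations removed. -/
def comp (E : List (Ev Proc In Out)) : List (Ev Proc In Out) :=
  E.filter (fun e => e.isRes || E.any (fun e' => e'.isRes && decide (e'.proc = e.proc)))

/-- `Ebar` extends `E` by appending zero or more matching responses to pending
invocations (well-formedness of `Ebar` forces the appended responses to match). -/
def Extension (E Ebar : List (Ev Proc In Out)) : Prop :=
  OneShotWF Ebar ∧ ∃ F, Ebar = E ++ F ∧ ∀ e ∈ F, e.isRes = true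

/-- Real-time precedence between the (one-shot) operation calls of processes `p` and `q`
in an execution: the response of `p` occurs before the invocation of `q`. -/
def Prec (E : List (Ev Proc In Out)) (p q : Proc) : Prop :=
  ∃ (i j : ℕ) (y : Out) (x : In),
    i < j ∧ E[i]? = some (Ev.res p y) ∧ E[j]? = some (Ev.inv q x)

/-- An invoking concurrency class: a nonempty finite set of invocations,
at most one per process. -/
def InvClass (C : Finset (Ev Proc In Out)) : Prop :=
  C.Nonempty ∧ (∀ e ∈ C, e.isInv = true) ∧
    ∀ e ∈ C, ∀ e' ∈ C, e.proc = e'.proc → e = e'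

/-- A responding concurrency class: a nonempty finite set of responses,
at most one per process. -/
def ResClass (C : Finset (Ev Proc In Out)) : Prop :=
  C.Nonempty ∧ (∀ e ∈ C, e.isRes = true) ∧
    ∀ e ∈ C, ∀ e' ∈ C, e.proc = e'.proc → e = e'

/-- An interval-sequential execution `I₀,R₀,I₁,R₁,…,I_m,R_m`, represented as a flat
list of concurrency classes: classes at even positions are invoking, classes at odd
positions are responding, and every response matches an invocation in an earlier
(or simultaneous-round) invoking class with no further invocation by the same
process in between. -/
def IsISExec (h : List (Finset (Ev Proc In Out))) : Prop :=
  h.length % 2 = 0 ∧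
  (∀ k C, h[k]? = some C → if k % 2 = 0 then InvClass C else ResClass C) ∧
  (∀ i C r, h[i]? = some C → i % 2 = 1 → r ∈ C →
    ∃ j, j ≤ i ∧ j % 2 = 0 ∧
      (∃ D, h[j]? = some D ∧ ∃ e ∈ D, e.isInv = true ∧ e.proc = r.proc) ∧
      ∀ j' D', j < j' → j' ≤ i → j' % 2 = 0 → h[j']? = some D' →
        ∀ e ∈ D', e.isInv = true → e.proc ≠ r.proc)

/-- An interval-sequential object: a Mealy automaton whose transitions, from a state
and a (nonempty) invoking concurrency class, produce a (nonempty) responding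
concurrency class and a next state; the response uniquely determines the new state. -/
structure ISObject (Proc In Out : Type) where
  State : Type
  init : Set State
  δ : State → Finset (Ev Proc In Out) → Set (Finset (Ev Proc In Out) × State)
  valid : ∀ q I R q', (R, q') ∈ δ q I → InvClass I ∧ ResClass R
  det : ∀ q I R q1 q2, (R, q1) ∈ δ q I → (R, q2) ∈ δ q I → q1 = q2

/-- The interval-sequential specification of an object: all interval-sequential
executions generated from an initial state by the transition relation. -/
def ISS (O : ISObject Proc In Out) : Set (List (Finset (Ev Proc In Out))) :=
  { h | IsISExec h ∧ ∃ q : ℕ → O.State, q 0 ∈ O.init ∧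
      ∀ i I R, h[2*i]? = some I → h[2*i+1]? = some R →
        (R, q (i+1)) ∈ O.δ (q i) I }

/-- Projection of an interval-sequential execution onto a process `p`
(each class contains at most one event of `p`). -/
noncomputable def projPIS (h : List (Finset (Ev Proc In Out))) (p : Proc) : List (Ev Proc In Out) :=
  h.flatMap (fun C => (C.filter (fun e => e.proc = p)).toList)

/-- The interval-sequential execution `h` respects the real-time order of `Ecomp`:
whenever the operation of `p` precedes that of `q`, every class containing an event
of `p` comes before every class containing an event of `q`. -/
def Respects (Ecomp : List (Ev Proc In Out)) (h : List (Finset (Ev Proc In Out))) : Prop :=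
  ∀ p q, Prec Ecomp p q →
    ∀ (k l : ℕ) (C D : Finset (Ev Proc In Out)), h[k]? = some C → h[l]? = some D →
      (∃ e ∈ C, e.proc = p) → (∃ e ∈ D, e.proc = q) → k < l

/-- `E` is interval-linearizable with respect to the object `O`. -/
def IntervalLin (O : ISObject Proc In Out) (E : List (Ev Proc In Out)) : Prop :=
  ∃ Ebar h, Extension E Ebar ∧ h ∈ ISS O ∧
    (∀ p, projP (comp Ebar) p = projPIS h p) ∧
    Respects (comp Ebar) h

/-- A task `(I, O, Δ)`: pure chromatic `(n-1)`-dimensional input and output complexes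
together with a carrier map `Δ`. -/
structure DTask (Proc In Out : Type) [DecidableEq Proc] [DecidableEq In]
    [DecidableEq Out] [Fintype Proc] where
  I : Set (Finset (Proc × In))
  O : Set (Finset (Proc × Out))
  Δ : Finset (Proc × In) → Set (Finset (Proc × Out))
  I_nonempty : I.Nonempty
  I_down : ∀ σ ∈ I, ∀ σ' ⊆ σ, σ' ∈ I
  O_down : ∀ τ ∈ O, ∀ τ' ⊆ τ, τ' ∈ O
  I_chromatic : ∀ σ ∈ I, ∀ v ∈ σ, ∀ w ∈ σ, (v : Proc × In).1 = w.1 → v = w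
  O_chromatic : ∀ τ ∈ O, ∀ v ∈ τ, ∀ w ∈ τ, (v : Proc × Out).1 = w.1 → v = w
  I_pure : ∀ σ ∈ I, ∃ σ' ∈ I, σ ⊆ σ' ∧ σ'.card = Fintype.card Proc
  O_pure : ∀ τ ∈ O, ∃ τ' ∈ O, τ ⊆ τ' ∧ τ'.card = Fintype.card Proc
  Δ_sub : ∀ σ ∈ I, Δ σ ⊆ O
  Δ_nonempty : ∀ σ ∈ I, (Δ σ).Nonempty
  Δ_down : ∀ σ ∈ I, ∀ τ ∈ Δ σ, ∀ τ' ⊆ τ, τ' ∈ Δ σ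
  Δ_pure : ∀ σ ∈ I, ∀ τ ∈ Δ σ, ∃ τ' ∈ Δ σ, τ ⊆ τ' ∧ τ'.card = σ.card
  Δ_ids : ∀ σ ∈ I, ∀ τ ∈ Δ σ, τ.card = σ.card →
    τ.image Prod.fst = σ.image Prod.fst
  Δ_mono : ∀ σ ∈ I, ∀ σ' ⊆ σ, Δ σ' ⊆ Δ σ

/-- `σ_E`: the input simplex of all invocations of an execution. -/
def inputSimplex (E : List (Ev Proc In Out)) : Finset (Proc × In) :=
  (E.filterMap (fun e => match e with | .inv p x => some (p, x) | _ => none)).toFinset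

/-- `τ_E`: the output simplex of all responses of an execution. -/
def outputSimplex (E : List (Ev Proc In Out)) : Finset (Proc × Out) :=
  (E.filterMap (fun e => match e with | .res p y => some (p, y) | _ => none)).toFinset

/-- `E` satisfies the task `T`: for every prefix `E'` of `E`, `τ_{E'} ∈ Δ(σ_{E'})`. -/
def Satisfies [Fintype Proc] (T : DTask Proc In Out) (E : List (Ev Proc In Out)) : Prop :=
  ∀ k, outputSimplex (E.take k) ∈ T.Δ (inputSimplex (E.take k))

/-! ## Statement: from tasks to interval-sequential objects -/

section Helpers

open scoped List

theorem List.pair_sublist_iff {α : Type*} {u v : α} {L : List α} :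
    [u, v] <+ L ↔ ∃ i j : ℕ, i < j ∧ L[i]? = some u ∧ L[j]? = some v := by
  induction L with
  | nil => simp
  | cons a L ih =>
    rw [List.sublist_cons_iff, ih]
    constructor
    · rintro (⟨i, j, hij, hi, hj⟩ | ⟨r, hr, hs⟩)
      · exact ⟨i + 1, j + 1, by omega, by simpa using hi, by simpa using hj⟩
      · obtain ⟨rfl, rfl⟩ := List.cons.inj hr
        obtain ⟨j, hj⟩ := List.mem_iff_getElem?.1 (List.singleton_sublist.1 hs)
        exact ⟨0, j + 1, by omega, by simp, by simpa using hj⟩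
    · rintro ⟨i, j, hij, hi, hj⟩
      obtain ⟨j, rfl⟩ : ∃ j', j = j' + 1 := ⟨j - 1, by omega⟩
      cases i with
      | zero =>
        obtain rfl : a = u := by simpa using hi
        exact Or.inr ⟨[v], rfl, List.singleton_sublist.2
          (List.mem_iff_getElem?.2 ⟨j, by simpa using hj⟩)⟩
      | succ i => exact Or.inl ⟨i, j, by omega, by simpa using hi, by simpa using hj⟩

theorem List.Nodup.not_pair_sublist_swap {α : Type*} {u v : α} {L : List α} (hL : L.Nodup)
    (h : [u, v] <+ L) : ¬ [v, u] <+ L := by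
  intro h'
  obtain ⟨i, j, hij, hi, hj⟩ := List.pair_sublist_iff.1 h
  obtain ⟨j', i', hij', hj', hi'⟩ := List.pair_sublist_iff.1 h'
  have h1 : i = i' := (List.getElem?_inj (List.getElem?_eq_some_iff.1 hi).1 hL).1 (hi.trans hi'.symm)
  have h2 : j = j' := (List.getElem?_inj (List.getElem?_eq_some_iff.1 hj).1 hL).1 (hj.trans hj'.symm)
  omega

theorem List.pair_sublist_flatten {α : Type*} {u v : α} {bl : List (List α)} {k l : ℕ}
    {C D : List α} (hkl : k < l) (hC : bl[k]? = some C) (hD : bl[l]? = some D)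
    (hu : u ∈ C) (hv : v ∈ D) : [u, v] <+ bl.flatten := by
  have h : [C, D] <+ bl := List.pair_sublist_iff.2 ⟨k, l, hkl, hC, hD⟩
  have h1 : C ++ D <+ bl.flatten := by simpa using h.flatten
  exact ((List.singleton_sublist.2 hu).append (List.singleton_sublist.2 hv)).trans h1

theorem List.Nodup.block_le_of_pair_sublist {α : Type*} {u v : α} {bl : List (List α)} {k l : ℕ}
    {C D : List α} (hnd : bl.flatten.Nodup) (h : [u, v] <+ bl.flatten)
    (hC : bl[k]? = some C) (hD : bl[l]? = some D) (hu : u ∈ C) (hv : v ∈ D) : k ≤ l := by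
  by_contra hlt
  exact hnd.not_pair_sublist_swap h (List.pair_sublist_flatten (not_le.1 hlt) hD hC hv hu)

theorem List.mem_flatten_iff_getElem? {α : Type*} {u : α} {bl : List (List α)} :
    u ∈ bl.flatten ↔ ∃ (k : ℕ) (C : List α), bl[k]? = some C ∧ u ∈ C := by
  rw [List.mem_flatten]
  constructor
  · rintro ⟨C, hC, hu⟩
    obtain ⟨k, hk⟩ := List.mem_iff_getElem?.1 hC
    exact ⟨k, C, hk, hu⟩
  · rintro ⟨k, C, hC, hu⟩
    exact ⟨C, List.mem_iff_getElem?.2 ⟨k, hC⟩, hu⟩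

omit [DecidableEq In] [DecidableEq Out] in
theorem mem_projP {E : List (Ev Proc In Out)} {p : Proc} {e : Ev Proc In Out} :
    e ∈ projP E p ↔ e ∈ E ∧ e.proc = p := by
  simp [projP]

omit [DecidableEq Proc] [DecidableEq In] [DecidableEq Out] in
theorem Ev.eq_inv {e : Ev Proc In Out} (h : e.isInv = true) : ∃ x, e = Ev.inv e.proc x := by
  cases e <;> simp_all [Ev.isInv, Ev.proc]

omit [DecidableEq Proc] [DecidableEq In] [DecidableEq Out] in
theorem Ev.eq_res {e : Ev Proc In Out} (h : e.isRes = true) : ∃ y, e = Ev.res e.proc y := by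
  cases e <;> simp_all [Ev.isRes, Ev.proc]

omit [DecidableEq Proc] [DecidableEq In] [DecidableEq Out] in
theorem Ev.isRes_eq_not_isInv (e : Ev Proc In Out) : e.isRes = !e.isInv := by
  cases e <;> rfl

omit [DecidableEq Out] in
theorem mem_inputSimplex {E : List (Ev Proc In Out)} {p : Proc} {x : In} :
    (p, x) ∈ inputSimplex E ↔ Ev.inv p x ∈ E := by
  simp only [inputSimplex, List.mem_toFinset, List.mem_filterMap]
  constructor
  · rintro ⟨e, he, h⟩
    cases e <;> simp_all
  · intro h
    exact ⟨_, h, rfl⟩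

omit [DecidableEq In] in
theorem mem_outputSimplex {E : List (Ev Proc In Out)} {p : Proc} {y : Out} :
    (p, y) ∈ outputSimplex E ↔ Ev.res p y ∈ E := by
  simp only [outputSimplex, List.mem_toFinset, List.mem_filterMap]
  constructor
  · rintro ⟨e, he, h⟩
    cases e <;> simp_all
  · intro h
    exact ⟨_, h, rfl⟩

omit [DecidableEq Out] in
theorem inputSimplex_subset {E E' : List (Ev Proc In Out)}
    (h : ∀ e ∈ E, e.isInv = true → e ∈ E') : inputSimplex E ⊆ inputSimplex E' := by
  rintro ⟨p, x⟩ hx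
  exact mem_inputSimplex.2 (h _ (mem_inputSimplex.1 hx) rfl)

omit [DecidableEq In] in
theorem outputSimplex_subset {E E' : List (Ev Proc In Out)}
    (h : ∀ e ∈ E, e.isRes = true → e ∈ E') : outputSimplex E ⊆ outputSimplex E' := by
  rintro ⟨p, y⟩ hy
  exact mem_outputSimplex.2 (h _ (mem_outputSimplex.1 hy) rfl)

omit [DecidableEq In] [DecidableEq Out] in
theorem mem_projPIS {h : List (Finset (Ev Proc In Out))} {p : Proc} {e : Ev Proc In Out} :
    e ∈ projPIS h p ↔ (∃ (k : ℕ) (C : Finset (Ev Proc In Out)), h[k]? = some C ∧ e ∈ C) ∧ e.proc = p := by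
  simp only [projPIS, List.mem_flatMap, Finset.mem_toList, Finset.mem_filter]
  constructor
  · rintro ⟨C, hC, he, hp⟩
    obtain ⟨k, hk⟩ := List.mem_iff_getElem?.1 hC
    exact ⟨⟨k, C, hk, he⟩, hp⟩
  · rintro ⟨⟨k, C, hk, he⟩, hp⟩
    exact ⟨C, List.mem_iff_getElem?.2 ⟨k, hk⟩, he, hp⟩

/-- The object of a task: the state records the events so far, and a round is allowed when the
resulting outputs are compatible with the resulting inputs. -/
noncomputable def taskObject [Fintype Proc] (T : DTask Proc In Out) : ISObject Proc In Out where
  State := Finset (Ev Proc In Out)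
  init := {∅}
  δ S I := {x | InvClass I ∧ ResClass x.1 ∧ x.2 = S ∪ I ∪ x.1 ∧
    outputSimplex x.2.toList ∈ T.Δ (inputSimplex x.2.toList)}
  valid := fun _ _ _ _ h => ⟨h.1, h.2.1⟩
  det := fun _ _ _ _ _ h h' => h.2.2.1.trans h'.2.2.1.symm

/-! ### Interval-linearizable executions satisfy the task -/

theorem mem_state_iff [Fintype Proc] {T : DTask Proc In Out} {h : List (Finset (Ev Proc In Out))}
    {q : ℕ → Finset (Ev Proc In Out)} (h0 : q 0 = ∅)
    (hq : ∀ i I R, h[2*i]? = some I → h[2*i+1]? = some R →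
      (R, q (i+1)) ∈ (taskObject T).δ (q i) I) (e : Ev Proc In Out) (i : ℕ)
    (hi : 2 * i ≤ h.length) :
    e ∈ q i ↔ ∃ k C, k < 2 * i ∧ h[k]? = some C ∧ e ∈ C := by
  induction i with
  | zero => simp [h0]
  | succ i ih =>
    have hI : h[2*i]? = some h[2*i] := List.getElem?_eq_getElem (by omega)
    have hR : h[2*i+1]? = some h[2*i+1] := List.getElem?_eq_getElem (by omega)
    have hs : q (i+1) = q i ∪ h[2*i] ∪ h[2*i+1] := (hq i _ _ hI hR).2.2.1
    rw [hs, Finset.mem_union, Finset.mem_union, ih (by omega)]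
    constructor
    · rintro ((⟨k, C, hk, hC, he⟩ | he) | he)
      · exact ⟨k, C, by omega, hC, he⟩
      · exact ⟨_, _, by omega, hI, he⟩
      · exact ⟨_, _, by omega, hR, he⟩
    · rintro ⟨k, C, hk, hC, he⟩
      rcases lt_trichotomy k (2*i) with hlt | rfl | hgt
      · exact Or.inl (Or.inl ⟨k, C, hlt, hC, he⟩)
      · rw [hI] at hC
        cases hC
        exact Or.inl (Or.inr he)
      · obtain rfl : k = 2*i+1 := by omega
        rw [hR] at hC
        cases hC
        exact Or.inr he

theorem satisfies_of_intervalLin [Fintype Proc] {T : DTask Proc In Out}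
    {E : List (Ev Proc In Out)} (hE : inputSimplex E ∈ T.I)
    (hlin : IntervalLin (taskObject T) E) : Satisfies T E := by
  obtain ⟨Ebar, h, ⟨-, F, rfl, hF⟩, ⟨⟨hlen, hcls, -⟩, q, h0, hq⟩, hproj, hresp⟩ := hlin
  change ℕ → Finset (Ev Proc In Out) at q
  change q 0 = ∅ at h0
  intro k
  have hpre : ∀ e ∈ E.take k, e ∈ E := fun e he => List.mem_of_mem_take he
  have hσ : inputSimplex (E.take k) ∈ T.I :=
    T.I_down _ hE _ (inputSimplex_subset fun e he _ => hpre e he)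
  have hmem : ∀ e, e ∈ comp (E ++ F) ↔
      ∃ (k : ℕ) (C : Finset (Ev Proc In Out)), h[k]? = some C ∧ e ∈ C := by
    intro e
    have h1 := mem_projP (E := comp (E ++ F)) (p := e.proc) (e := e)
    rw [hproj, mem_projPIS] at h1
    simpa using h1.symm
  have hres : ∀ e ∈ E.take k, e.isRes = true →
      ∃ (k : ℕ) (C : Finset (Ev Proc In Out)), h[k]? = some C ∧ e ∈ C := by
    intro e he hr
    rw [← hmem]
    simp [comp, hr, hpre e he]
  by_cases hnone : ∀ e ∈ E.take k, e.isRes = false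
  · obtain ⟨τ, hτ⟩ := T.Δ_nonempty _ hσ
    refine T.Δ_down _ hσ τ hτ _ ?_
    rintro ⟨p, y⟩ hy
    simpa [Ev.isRes] using hnone _ (mem_outputSimplex.1 hy)
  · push Not at hnone
    obtain ⟨e₀, he₀, hr₀⟩ := hnone
    simp only [ne_eq, Bool.not_eq_false] at hr₀
    classical
    let s := (Finset.range h.length).filter
      (fun i => ∃ C, h[i]? = some C ∧ ∃ e ∈ C, e.isRes = true ∧ e ∈ E.take k)
    have hs : ∀ {i C e}, h[i]? = some C → e ∈ C → e.isRes = true → e ∈ E.take k → i ∈ s := by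
      intro i C e hC he hr hek
      exact Finset.mem_filter.2 ⟨Finset.mem_range.2 (List.getElem?_eq_some_iff.1 hC).1,
        C, hC, e, he, hr, hek⟩
    have hsne : s.Nonempty := by
      obtain ⟨i, C, hC, he⟩ := hres _ he₀ hr₀
      exact ⟨i, hs hC he hr₀ he₀⟩
    obtain ⟨i, his, hmax⟩ := Finset.exists_max_image s id hsne
    obtain ⟨hil, R, hR, r, hrR, hr, hrk⟩ := Finset.mem_filter.1 his
    rw [Finset.mem_range] at hil
    have hodd : i % 2 = 1 := by
      by_contra hne
      have h1 := hcls i R hR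
      rw [if_pos (by omega)] at h1
      have h2 := h1.2.1 r hrR
      rw [Ev.isRes_eq_not_isInv, h2] at hr
      simp at hr
    obtain ⟨m, rfl⟩ : ∃ m, i = 2 * m + 1 := ⟨i / 2, by omega⟩
    have hI : h[2*m]? = some h[2*m] := List.getElem?_eq_getElem (by omega)
    have hδ := (hq m _ _ hI hR).2.2.2
    have hst := fun e => mem_state_iff (T := T) h0 hq e (m + 1) (by omega)
    have hsub : inputSimplex (q (m+1)).toList ⊆ inputSimplex (E.take k) := by
      apply inputSimplex_subset
      intro e he hinv
      rw [Finset.mem_toList, hst] at he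
      obtain ⟨j, C, hj, hC, heC⟩ := he
      by_contra hek
      have hec : e ∈ comp (E ++ F) := (hmem e).2 ⟨j, C, hC, heC⟩
      have hEd : E ++ F = E.take k ++ (E.drop k ++ F) := by
        rw [← List.append_assoc, List.take_append_drop]
      have hed : e ∈ E.drop k ++ F := by
        have h1 : e ∈ E ++ F := List.mem_of_mem_filter hec
        rw [hEd] at h1
        exact (List.mem_append.1 h1).resolve_left hek
      have hpair : [r, e] <+ E ++ F := by
        rw [hEd]
        exact (List.singleton_sublist.2 hrk).append (List.singleton_sublist.2 hed)
      have hpair' : [r, e] <+ comp (E ++ F) := by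
        have h2 := hpair.filter (fun e => e.isRes ||
          (E ++ F).any (fun e' => e'.isRes && decide (e'.proc = e.proc)))
        rw [List.filter_cons_of_pos (by simp [hr]),
          List.filter_cons_of_pos (List.of_mem_filter hec)] at h2
        exact h2
      obtain ⟨a, b, hab, ha, hb⟩ := List.pair_sublist_iff.1 hpair'
      obtain ⟨x, hx⟩ := Ev.eq_inv hinv
      obtain ⟨y, hy⟩ := Ev.eq_res hr
      have := hresp r.proc e.proc ⟨a, b, y, x, hab, by rw [← hy]; exact ha, by rw [← hx]; exact hb⟩
        _ _ _ _ hR hC ⟨r, hrR, rfl⟩ ⟨e, heC, rfl⟩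
      omega
    refine T.Δ_down _ hσ _ (T.Δ_mono _ hσ _ hsub hδ) _ (outputSimplex_subset ?_)
    intro e he her
    obtain ⟨j, C, hC, heC⟩ := hres e he her
    rw [Finset.mem_toList, hst]
    have := hmax j (hs hC heC her he)
    simp only [id_eq] at this
    exact ⟨j, C, by omega, hC, heC⟩

/-! ### Complete executions -/

/-- A well-formed one-shot execution without pending invocations. -/
def CompleteExec (L : List (Ev Proc In Out)) : Prop :=
  ∀ p, projP L p = [] ∨ ∃ x y, projP L p = [Ev.inv p x, Ev.res p y]

namespace CompleteExec

variable {L : List (Ev Proc In Out)}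

omit [DecidableEq In] [DecidableEq Out] in
theorem oneShotWF (hL : CompleteExec L) : OneShotWF L := fun p =>
  (hL p).elim Or.inl fun h => Or.inr (Or.inr h)

omit [DecidableEq In] [DecidableEq Out] in
theorem projP_eq (hL : CompleteExec L) {e : Ev Proc In Out} (he : e ∈ L) :
    ∃ x y, projP L e.proc = [Ev.inv e.proc x, Ev.res e.proc y] := by
  refine (hL e.proc).resolve_left fun h => ?_
  have : e ∈ projP L e.proc := mem_projP.2 ⟨he, rfl⟩
  simp [h] at this

theorem nodup (hL : CompleteExec L) : L.Nodup := by
  rw [List.nodup_iff_count_le_one]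
  intro e
  have h1 : (projP L e.proc).count e = L.count e := List.count_filter (by simp)
  rw [← h1]
  refine List.nodup_iff_count_le_one.1 ?_ e
  rcases hL e.proc with h | ⟨x, y, h⟩ <;> simp [h]

omit [DecidableEq In] [DecidableEq Out] in
theorem eq_of_isInv (hL : CompleteExec L) {e e' : Ev Proc In Out} (he : e ∈ L) (he' : e' ∈ L)
    (hp : e.proc = e'.proc) (hk : e.isInv = e'.isInv) : e = e' := by
  obtain ⟨x, y, h⟩ := hL.projP_eq he
  have h1 : e ∈ projP L e.proc := mem_projP.2 ⟨he, rfl⟩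
  have h2 : e' ∈ projP L e.proc := mem_projP.2 ⟨he', hp.symm⟩
  rw [h] at h1 h2
  simp only [List.mem_cons, List.not_mem_nil, or_false] at h1 h2
  rcases h1 with h1 | h1 <;> rcases h2 with h2 | h2 <;> rw [h1, h2] at hk ⊢ <;>
    simp [Ev.isInv] at hk

omit [DecidableEq In] [DecidableEq Out] in
theorem comp_eq (hL : CompleteExec L) : comp L = L := by
  rw [comp, List.filter_eq_self]
  intro e he
  obtain ⟨x, y, h⟩ := hL.projP_eq he
  have h2 : Ev.res e.proc y ∈ L := (mem_projP.1 (by rw [h]; simp : _ ∈ projP L e.proc)).1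
  rw [Bool.or_eq_true, List.any_eq_true]
  exact Or.inr ⟨_, h2, by simp [Ev.isRes, Ev.proc]⟩

omit [DecidableEq In] [DecidableEq Out] in
theorem exists_inv_sublist (hL : CompleteExec L) {e : Ev Proc In Out} (he : e ∈ L)
    (hr : e.isRes = true) : ∃ x, [Ev.inv e.proc x, e] <+ L := by
  obtain ⟨x, y, h⟩ := hL.projP_eq he
  obtain ⟨y', hy'⟩ := Ev.eq_res hr
  have h1 : e ∈ projP L e.proc := mem_projP.2 ⟨he, rfl⟩
  have h2 : e = Ev.res e.proc y := by
    rw [h] at h1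
    simp only [List.mem_cons, List.not_mem_nil, or_false] at h1
    refine h1.resolve_left fun h3 => ?_
    rw [h3] at hr
    simp [Ev.isRes] at hr
  refine ⟨x, ?_⟩
  rw [← h2] at h
  rw [← h]
  exact List.filter_sublist

omit [DecidableEq In] [DecidableEq Out] in
theorem exists_isRes_of_append (hL : CompleteExec L) {L₁ L₂ : List (Ev Proc In Out)}
    {e : Ev Proc In Out} (h : L = L₁ ++ e :: L₂) (he : e.isInv = true) :
    ∃ r ∈ L₂, r.isRes = true := by
  obtain ⟨x, y, hp⟩ := hL.projP_eq (e := e) (by simp [h])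
  rw [h, projP, List.filter_append, List.filter_cons_of_pos (by simp)] at hp
  rcases hf : L₁.filter (fun e' => decide (e'.proc = e.proc)) with _ | ⟨a, t⟩
  · rw [hf, List.nil_append] at hp
    have h1 : Ev.res e.proc y ∈ L₂.filter (fun e' => decide (e'.proc = e.proc)) := by
      rw [(List.cons.inj hp).2]
      simp
    exact ⟨_, List.mem_of_mem_filter h1, rfl⟩
  · rw [hf, List.cons_append] at hp
    have h1 := (List.cons.inj hp).2
    rcases t with _ | ⟨b, t⟩
    · rw [List.nil_append] at h1
      rw [(List.cons.inj h1).1] at he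
      simp [Ev.isInv] at he
    · simp at h1

omit [DecidableEq In] [DecidableEq Out] in
theorem isInv_head (hL : CompleteExec L) {e : Ev Proc In Out} {L' : List (Ev Proc In Out)}
    (h : L = e :: L') : e.isInv = true := by
  obtain ⟨x, y, hp⟩ := hL.projP_eq (e := e) (by simp [h])
  rw [h, projP, List.filter_cons_of_pos (by simp)] at hp
  rw [(List.cons.inj hp).1]
  rfl

end CompleteExec

/-! ### Grouping a complete execution into concurrency classes -/

/-- Blocks of events alternating between nonempty blocks of invocations and nonempty blocks of
responses. -/
def AlternatingBlocks (bl : List (List (Ev Proc In Out))) : Prop :=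
  bl.length % 2 = 0 ∧ ∀ k C, bl[k]? = some C →
    C ≠ [] ∧ ∀ e ∈ C, e.isInv = decide (k % 2 = 0)

omit [DecidableEq Proc] [DecidableEq In] [DecidableEq Out] in
theorem exists_alternatingBlocks_append (L : List (Ev Proc In Out))
    (hL : ∀ L₁ e L₂, L = L₁ ++ e :: L₂ → e.isInv = true → ∃ r ∈ L₂, r.isRes = true) :
    ∃ B bl, L = B ++ bl.flatten ∧ (∀ e ∈ B, e.isRes = true) ∧ AlternatingBlocks bl := by
  induction L with
  | nil => exact ⟨[], [], by simp, by simp, by simp [AlternatingBlocks]⟩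
  | cons e L ih =>
    obtain ⟨B, bl, hB, hBr, hlen, hbl⟩ := ih fun L₁ e' L₂ h he =>
      hL (e :: L₁) e' L₂ (by rw [h, List.cons_append]) he
    by_cases he : e.isInv = true
    · rcases B with _ | ⟨b, B⟩
      · rcases bl with _ | ⟨a, bl⟩
        · obtain ⟨r, hr, -⟩ := hL [] e L rfl he
          simp [hB] at hr
        · refine ⟨[], (e :: a) :: bl, by simp [hB], by simp, by simpa using hlen, ?_⟩
          intro k C hC
          cases k with
          | zero =>
            obtain rfl : e :: a = C := by simpa using hC
            refine ⟨by simp, fun e' he' => ?_⟩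
            rcases List.mem_cons.1 he' with rfl | he'
            · simpa using he
            · exact (hbl 0 a (by simp)).2 e' he'
          | succ k => exact hbl (k + 1) C (by simpa using hC)
      · refine ⟨[], [e] :: (b :: B) :: bl, by simp [hB], by simp, by simp; omega, ?_⟩
        intro k C hC
        match k with
        | 0 =>
          obtain rfl : [e] = C := by simpa using hC
          simpa using he
        | 1 =>
          obtain rfl : b :: B = C := by simpa using hC
          refine ⟨by simp, fun e' he' => ?_⟩
          have := hBr e' he'
          rw [Ev.isRes_eq_not_isInv] at this
          simpa using this
        | k + 2 =>
          have := hbl k C (by simpa using hC)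
          simpa using this
    · refine ⟨e :: B, bl, by simp [hB], ?_, hlen, hbl⟩
      intro e' he'
      rcases List.mem_cons.1 he' with rfl | he'
      · rw [Ev.isRes_eq_not_isInv]
        simpa using he
      · exact hBr e' he'

omit [DecidableEq In] [DecidableEq Out] in
theorem CompleteExec.exists_alternatingBlocks {L : List (Ev Proc In Out)} (hL : CompleteExec L) :
    ∃ bl, L = bl.flatten ∧ AlternatingBlocks bl := by
  obtain ⟨B, bl, h, hB, hbl⟩ := exists_alternatingBlocks_append L
    fun _ _ _ h he => hL.exists_isRes_of_append h he
  rcases B with _ | ⟨b, B⟩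
  · exact ⟨bl, h, hbl⟩
  · have h1 := hL.isInv_head h
    have h2 := hB b (by simp)
    rw [Ev.isRes_eq_not_isInv, h1] at h2
    simp at h2

/-- The concurrency classes underlying a list of blocks. -/
def blockClasses (bl : List (List (Ev Proc In Out))) : List (Finset (Ev Proc In Out)) :=
  bl.map List.toFinset

theorem getElem?_blockClasses {bl : List (List (Ev Proc In Out))} {k : ℕ}
    {C : Finset (Ev Proc In Out)} :
    (blockClasses bl)[k]? = some C ↔ ∃ B, bl[k]? = some B ∧ B.toFinset = C := by
  simp [blockClasses]

section Blocks

variable {bl : List (List (Ev Proc In Out))}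

theorem isISExec_blockClasses (hL : CompleteExec bl.flatten) (hbl : AlternatingBlocks bl) :
    IsISExec (blockClasses bl) := by
  refine ⟨by simpa [blockClasses] using hbl.1, ?_, ?_⟩
  · intro k C hC
    obtain ⟨B, hB, rfl⟩ := getElem?_blockClasses.1 hC
    obtain ⟨hne, hk⟩ := hbl.2 k B hB
    have hne' : B.toFinset.Nonempty := by simpa [List.toFinset_nonempty_iff] using hne
    have huniq : ∀ e ∈ B.toFinset, ∀ e' ∈ B.toFinset, e.proc = e'.proc → e = e' := by
      intro e he e' he' hp
      rw [List.mem_toFinset] at he he'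
      exact hL.eq_of_isInv (List.mem_flatten_iff_getElem?.2 ⟨k, B, hB, he⟩)
        (List.mem_flatten_iff_getElem?.2 ⟨k, B, hB, he'⟩) hp ((hk e he).trans (hk e' he').symm)
    split_ifs with hpar
    · refine ⟨hne', fun e he => ?_, huniq⟩
      simpa [hpar] using hk e (List.mem_toFinset.1 he)
    · refine ⟨hne', fun e he => ?_, huniq⟩
      rw [Ev.isRes_eq_not_isInv, hk e (List.mem_toFinset.1 he)]
      simp [hpar]
  · intro i C r hC hi hr
    obtain ⟨B, hB, rfl⟩ := getElem?_blockClasses.1 hC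
    rw [List.mem_toFinset] at hr
    have hrres : r.isRes = true := by
      rw [Ev.isRes_eq_not_isInv, (hbl.2 i B hB).2 r hr]
      simp [hi]
    obtain ⟨x, hx⟩ := hL.exists_inv_sublist (List.mem_flatten_iff_getElem?.2 ⟨i, B, hB, hr⟩) hrres
    have hxL : Ev.inv r.proc x ∈ bl.flatten := hx.subset (by simp)
    obtain ⟨j, D, hD, hxD⟩ := List.mem_flatten_iff_getElem?.1 hxL
    refine ⟨j, hL.nodup.block_le_of_pair_sublist hx hD hB hxD hr, ?_,
      ⟨D.toFinset, getElem?_blockClasses.2 ⟨D, hD, rfl⟩, _, List.mem_toFinset.2 hxD, rfl, rfl⟩, ?_⟩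
    · simpa [Ev.isInv] using (hbl.2 j D hD).2 _ hxD
    · intro j' D' hj hj' _ hD' e he heinv hp
      obtain ⟨B', hB', rfl⟩ := getElem?_blockClasses.1 hD'
      rw [List.mem_toFinset] at he
      have heq : e = Ev.inv r.proc x :=
        hL.eq_of_isInv (List.mem_flatten_iff_getElem?.2 ⟨j', B', hB', he⟩) hxL hp heinv
      subst heq
      have h1 := List.pair_sublist_flatten hj hD hB' hxD he
      exact hL.nodup.not_pair_sublist_swap h1 h1

theorem projPIS_blockClasses (hL : CompleteExec bl.flatten) (hbl : AlternatingBlocks bl)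
    (p : Proc) : projPIS (blockClasses bl) p = projP bl.flatten p := by
  rw [projPIS, projP, blockClasses, List.flatMap_map, List.filter_flatten, ← List.flatMap_def]
  apply List.flatMap_congr
  intro B hB
  obtain ⟨k, hk⟩ := List.mem_iff_getElem?.1 hB
  have hkind : ∀ e ∈ B.filter (fun e => decide (e.proc = p)), e.isInv = decide (k % 2 = 0) :=
    fun e he => (hbl.2 k B hk).2 e (List.mem_of_mem_filter he)
  have hsub : B.filter (fun e => decide (e.proc = p)) <+ projP bl.flatten p :=
    (List.sublist_flatten_of_mem hB).filter _
  have hfilter : B.toFinset.filter (fun e => e.proc = p) =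
      (B.filter (fun e => decide (e.proc = p))).toFinset := by
    ext e
    simp
  rw [hfilter]
  generalize B.filter (fun e => decide (e.proc = p)) = l at hkind hsub
  rcases l with _ | ⟨a, _ | ⟨b, t⟩⟩
  · simp
  · simp
  · exfalso
    have hab : [a, b] <+ projP bl.flatten p := (by simp : [a, b] <+ a :: b :: t).trans hsub
    have hmem : ∀ e ∈ [a, b], e ∈ bl.flatten ∧ e.proc = p := fun e he =>
      mem_projP.1 (hab.subset he)
    have ha := hmem a (by simp)
    have hb := hmem b (by simp)
    have heq : a = b := hL.eq_of_isInv ha.1 hb.1 (ha.2.trans hb.2.symm)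
      ((hkind a (by simp)).trans (hkind b (by simp)).symm)
    subst heq
    have h1 := hab.trans List.filter_sublist
    exact hL.nodup.not_pair_sublist_swap h1 h1

theorem respects_blockClasses (hL : CompleteExec bl.flatten) (hbl : AlternatingBlocks bl) :
    Respects bl.flatten (blockClasses bl) := by
  rintro p q ⟨i, j, y, x, hij, hi, hj⟩ k l C D hC hD ⟨e, he, rfl⟩ ⟨f, hf, rfl⟩
  obtain ⟨B, hB, rfl⟩ := getElem?_blockClasses.1 hC
  obtain ⟨B', hB', rfl⟩ := getElem?_blockClasses.1 hD
  rw [List.mem_toFinset] at he hf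
  have heL := List.mem_flatten_iff_getElem?.2 ⟨k, B, hB, he⟩
  have hfL := List.mem_flatten_iff_getElem?.2 ⟨l, B', hB', hf⟩
  have hpair := List.pair_sublist_iff.2 ⟨i, j, hij, hi, hj⟩
  have hu : Ev.res e.proc y ∈ bl.flatten := hpair.subset (by simp)
  have hv : Ev.inv f.proc x ∈ bl.flatten := hpair.subset (by simp)
  obtain ⟨a, A, hA, huA, hka⟩ : ∃ a A, bl[a]? = some A ∧ Ev.res e.proc y ∈ A ∧ k ≤ a := by
    by_cases hei : e.isInv = true
    · obtain ⟨a, A, hA, huA⟩ := List.mem_flatten_iff_getElem?.1 hu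
      obtain ⟨x', hx'⟩ := hL.exists_inv_sublist hu rfl
      have heq : e = Ev.inv e.proc x' :=
        hL.eq_of_isInv heL (hx'.subset (by simp [Ev.proc])) rfl hei
      refine ⟨a, A, hA, huA, hL.nodup.block_le_of_pair_sublist ?_ hB hA he huA⟩
      rw [heq]
      exact hx'
    · have heq : e = Ev.res e.proc y := hL.eq_of_isInv heL hu rfl (by simpa [Ev.isInv] using hei)
      exact ⟨k, B, hB, heq ▸ he, le_rfl⟩
  obtain ⟨b, A', hA', hvA', hbl'⟩ : ∃ b A, bl[b]? = some A ∧ Ev.inv f.proc x ∈ A ∧ b ≤ l := by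
    by_cases hfi : f.isInv = true
    · have heq : f = Ev.inv f.proc x := hL.eq_of_isInv hfL hv rfl hfi
      exact ⟨l, B', hB', heq ▸ hf, le_rfl⟩
    · obtain ⟨b, A, hA, hvA⟩ := List.mem_flatten_iff_getElem?.1 hv
      obtain ⟨x', hx'⟩ := hL.exists_inv_sublist hfL (by rw [Ev.isRes_eq_not_isInv]; simpa using hfi)
      have heq : Ev.inv f.proc x' = Ev.inv f.proc x :=
        hL.eq_of_isInv (hx'.subset (by simp)) hv rfl rfl
      rw [heq] at hx'
      exact ⟨b, A, hA, hvA, hL.nodup.block_le_of_pair_sublist hx' hA hB' hvA hf⟩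
  have hab := hL.nodup.block_le_of_pair_sublist hpair hA hA' huA hvA'
  have h1 := (hbl.2 a A hA).2 _ huA
  have h2 := (hbl.2 b A' hA').2 _ hvA'
  simp only [Ev.isInv] at h1 h2
  have h3 : ¬ a % 2 = 0 := of_decide_eq_false h1.symm
  have h4 : b % 2 = 0 := of_decide_eq_true h2.symm
  have : a ≠ b := by
    rintro rfl
    exact h3 h4
  omega

theorem blockClasses_mem_ISS [Fintype Proc] {T : DTask Proc In Out}
    (hL : CompleteExec bl.flatten) (hbl : AlternatingBlocks bl)
    (hsat : ∀ L, L <+: bl.flatten → outputSimplex L ∈ T.Δ (inputSimplex L)) :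
    blockClasses bl ∈ ISS (taskObject T) := by
  have hIS := isISExec_blockClasses hL hbl
  refine ⟨hIS, fun i => (bl.take (2 * i)).flatten.toFinset,
    by simp only [Nat.mul_zero, List.take_zero]; exact Set.mem_singleton _, ?_⟩
  intro i I R hI hR
  have hI' := hIS.2.1 _ _ hI
  have hR' := hIS.2.1 _ _ hR
  rw [if_pos (by omega)] at hI'
  rw [if_neg (by omega)] at hR'
  obtain ⟨A, hA, rfl⟩ := getElem?_blockClasses.1 hI
  obtain ⟨B, hB, rfl⟩ := getElem?_blockClasses.1 hR
  have htake : bl.take (2 * (i + 1)) = bl.take (2 * i) ++ [A] ++ [B] := by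
    rw [show 2 * (i + 1) = 2 * i + 1 + 1 by ring, List.take_add_one, hB, List.take_add_one, hA]
    rfl
  refine ⟨hI', hR', ?_, ?_⟩
  · show ((bl.take (2 * (i + 1))).flatten).toFinset = _
    rw [htake]
    simp [Finset.union_assoc]
  · show outputSimplex ((bl.take (2 * (i + 1))).flatten).toFinset.toList ∈
      T.Δ (inputSimplex ((bl.take (2 * (i + 1))).flatten).toFinset.toList)
    have hin : inputSimplex ((bl.take (2 * (i + 1))).flatten).toFinset.toList =
        inputSimplex (bl.take (2 * (i + 1))).flatten :=
      Finset.Subset.antisymm (inputSimplex_subset fun e he _ => by simpa using he)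
        (inputSimplex_subset fun e he _ => by simpa using he)
    have hout : outputSimplex ((bl.take (2 * (i + 1))).flatten).toFinset.toList =
        outputSimplex (bl.take (2 * (i + 1))).flatten :=
      Finset.Subset.antisymm (outputSimplex_subset fun e he _ => by simpa using he)
        (outputSimplex_subset fun e he _ => by simpa using he)
    rw [hin, hout]
    exact hsat _ (List.IsPrefix.flatten ⟨_, List.take_append_drop _ _⟩)

end Blocks

/-! ### Executions satisfying the task are interval-linearizable -/

theorem Satisfies.exists_complete_extension [Fintype Proc] {T : DTask Proc In Out}
    {E : List (Ev Proc In Out)} (hwf : OneShotWF E) (hE : inputSimplex E ∈ T.I)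
    (hsat : Satisfies T E) :
    ∃ F, (∀ e ∈ F, e.isRes = true) ∧ CompleteExec (E ++ F) ∧
      ∀ L, L <+: E ++ F → outputSimplex L ∈ T.Δ (inputSimplex L) := by
  have hEsat : outputSimplex E ∈ T.Δ (inputSimplex E) := by
    simpa using hsat E.length
  obtain ⟨τ, hτ, hsub, hcard⟩ := T.Δ_pure _ hE _ hEsat
  have hids := T.Δ_ids _ hE τ hτ hcard
  have hchr := T.O_chromatic τ (T.Δ_sub _ hE hτ)
  set F : List (Ev Proc In Out) :=
    (τ \ outputSimplex E).toList.map (fun v => Ev.res v.1 v.2) with hFdef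
  have hFmem : ∀ {e}, e ∈ F ↔ ∃ p y, e = Ev.res p y ∧ (p, y) ∈ τ ∧ Ev.res p y ∉ E := by
    intro e
    simp only [hFdef, List.mem_map, Finset.mem_toList, Finset.mem_sdiff, Prod.exists,
      mem_outputSimplex]
    constructor
    · rintro ⟨p, y, ⟨h1, h2⟩, rfl⟩
      exact ⟨p, y, rfl, h1, h2⟩
    · rintro ⟨p, y, rfl, h1, h2⟩
      exact ⟨p, y, ⟨h1, h2⟩, rfl⟩
  have hFnd : F.Nodup := (Finset.nodup_toList _).map fun v w h => by
    simp only [Ev.res.injEq] at h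
    exact Prod.ext h.1 h.2
  have hFres : ∀ e ∈ F, e.isRes = true := by
    intro e he
    obtain ⟨p, y, rfl, -, -⟩ := hFmem.1 he
    rfl
  have hid : ∀ p, (∃ y, (p, y) ∈ τ) ↔ ∃ x, Ev.inv p x ∈ E := by
    intro p
    have := congrArg (p ∈ ·) hids
    simpa [mem_inputSimplex] using this
  have hproj : ∀ p, projP (E ++ F) p = projP E p ++ projP F p := fun p => List.filter_append _ _
  refine ⟨F, hFres, ?_, ?_⟩
  · intro p
    rcases hwf p with h | ⟨x, h⟩ | ⟨x, y, h⟩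
    · left
      rw [hproj, h, List.nil_append, List.eq_nil_iff_forall_not_mem]
      intro e he
      obtain ⟨heF, hp⟩ := mem_projP.1 he
      obtain ⟨p', y, rfl, hy, -⟩ := hFmem.1 heF
      obtain rfl : p' = p := hp
      obtain ⟨x, hx⟩ := (hid p').1 ⟨y, hy⟩
      have : Ev.inv p' x ∈ projP E p' := mem_projP.2 ⟨hx, rfl⟩
      simp [h] at this
    · right
      have hx : Ev.inv p x ∈ E := (mem_projP.1 (by rw [h]; simp : _ ∈ projP E p)).1
      obtain ⟨y, hy⟩ := (hid p).2 ⟨x, hx⟩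
      refine ⟨x, y, ?_⟩
      have hFp : projP F p = [Ev.res p y] := by
        rw [← List.perm_singleton]
        refine (List.perm_ext_iff_of_nodup (hFnd.filter _) (List.nodup_singleton _)).2 fun e => ?_
        change e ∈ projP F p ↔ _
        rw [mem_projP, hFmem, List.mem_singleton]
        constructor
        · rintro ⟨⟨p', y', rfl, hy', -⟩, hp⟩
          obtain rfl : p' = p := hp
          have := hchr _ hy' _ hy rfl
          simp_all
        · rintro rfl
          refine ⟨⟨p, y, rfl, hy, fun hmem => ?_⟩, rfl⟩
          have : Ev.res p y ∈ projP E p := mem_projP.2 ⟨hmem, rfl⟩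
          simp [h] at this
      rw [hproj, h, hFp]
      rfl
    · right
      refine ⟨x, y, ?_⟩
      have hyE : Ev.res p y ∈ E := (mem_projP.1 (by rw [h]; simp : _ ∈ projP E p)).1
      have hFp : projP F p = [] := by
        rw [List.eq_nil_iff_forall_not_mem]
        intro e he
        obtain ⟨heF, hp⟩ := mem_projP.1 he
        obtain ⟨p', y', rfl, hy', hn⟩ := hFmem.1 heF
        obtain rfl : p' = p := hp
        have := hchr _ hy' _ (hsub (mem_outputSimplex.2 hyE)) rfl
        simp only [Prod.mk.injEq, true_and] at this
        exact hn (this ▸ hyE)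
      rw [hproj, h, hFp, List.append_nil]
  · intro L hL
    rw [List.prefix_iff_eq_take] at hL
    rw [List.take_append] at hL
    rcases le_total L.length E.length with hle | hle
    · rw [Nat.sub_eq_zero_of_le hle, List.take_zero, List.append_nil] at hL
      rw [hL]
      exact hsat _
    · rw [List.take_of_length_le hle] at hL
      have hin : inputSimplex L = inputSimplex E := by
        refine Finset.Subset.antisymm (inputSimplex_subset fun e he hi => ?_)
          (inputSimplex_subset fun e he _ => by rw [hL]; simp [he])
        rw [hL, List.mem_append] at he
        refine he.resolve_right fun h => ?_
        have := hFres e (List.mem_of_mem_take h)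
        rw [Ev.isRes_eq_not_isInv, hi] at this
        simp at this
      rw [hin]
      refine T.Δ_down _ hE τ hτ _ ?_
      rintro ⟨p, y⟩ hy
      rw [mem_outputSimplex, hL, List.mem_append] at hy
      rcases hy with hy | hy
      · exact hsub (mem_outputSimplex.2 hy)
      · obtain ⟨p', y', heq, hy', -⟩ := hFmem.1 (List.mem_of_mem_take hy)
        simp only [Ev.res.injEq] at heq
        rw [heq.1, heq.2]
        exact hy'

theorem Satisfies.intervalLin [Fintype Proc] {T : DTask Proc In Out}
    {E : List (Ev Proc In Out)} (hwf : OneShotWF E) (hE : inputSimplex E ∈ T.I)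
    (hsat : Satisfies T E) : IntervalLin (taskObject T) E := by
  obtain ⟨F, hF, hL, hsat'⟩ := hsat.exists_complete_extension hwf hE
  obtain ⟨bl, heq, hbl⟩ := hL.exists_alternatingBlocks
  refine ⟨E ++ F, blockClasses bl, ⟨hL.oneShotWF, F, rfl, hF⟩, ?_, ?_, ?_⟩
  · rw [heq] at hL hsat'
    exact blockClasses_mem_ISS hL hbl hsat'
  · rw [hL.comp_eq]
    rw [heq] at hL ⊢
    exact fun p => (projPIS_blockClasses hL hbl p).symm
  · rw [hL.comp_eq]
    rw [heq] at hL ⊢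
    exact respects_blockClasses hL hbl

end Helpers

/-- **From tasks to interval-sequential objects.** For every task `T` there is an
interval-sequential object `O_T` (with a single operation) such that a (well-formed,
one-shot, with inputs forming an input simplex of `T`) execution `E` satisfies `T`
if and only if `E` is interval-linearizable with respect to `O_T`. -/
theorem tasks_to_interval_sequential_objects
    {Proc In Out : Type} [DecidableEq Proc] [DecidableEq In] [DecidableEq Out]
    [Fintype Proc] (T : DTask Proc In Out) :
    ∃ OT : ISObject Proc In Out,
      ∀ E : List (Ev Proc In Out), OneShotWF E → inputSimplex E ∈ T.I →
        (Satisfies T E ↔ IntervalLin OT E) := by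
  exact ⟨taskObject T, fun _ hwf hE =>
    ⟨fun h => h.intervalLin hwf hE, satisfies_of_intervalLin hE⟩⟩
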